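/- arXiv:1601.04904 — 5 statements merged into one kernel-verified Lean document; each statement's English description precedes it below -/
import Mathlib

section
/- N(F_{i−1}) ∩ F_j = N(F_{i−1}) ∩ F_{j−1}. -/
open Submodule

/-- Let `F` be a refinement (full flag) of an `n`-dimensional `E`-vector space `D`, and
`N : D → D` a linear map with `N(F_i) ⊆ F_i`.  Fix `i` with `N(F_i) ≠ N(F_{i-1})` and let
`j` be minimal with `N(F_i) ⊆ N(F_{i-1}) + F_j`.  Then
`N(F_{i-1}) ∩ F_j = N(F_{i-1}) ∩ F_{j-1}`. -/
theorem map_inter_eq_of_minimal (E D : Type*) [Field E] [AddCommGroup D] [Module E D]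
    [FiniteDimensional E D] (n : ℕ) (hn : Module.finrank E D = n)
    (F : ℕ → Submodule E D) (hmono : Monotone F) (hF0 : F 0 = ⊥) (hFn : F n = ⊤)
    (hdim : ∀ r ≤ n, Module.finrank E (F r) = r)
    (N : D →ₗ[E] D) (hNF : ∀ r, (F r).map N ≤ F r)
    (i : ℕ) (hi1 : 1 ≤ i) (hin : i ≤ n)
    (hne : (F i).map N ≠ (F (i - 1)).map N)
    (j : ℕ) (hj : (F i).map N ≤ (F (i - 1)).map N ⊔ F j)
    (hjmin : ∀ j' < j, ¬ ((F i).map N ≤ (F (i - 1)).map N ⊔ F j')) :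
    (F (i - 1)).map N ⊓ F j = (F (i - 1)).map N ⊓ F (j - 1) := by
  refine le_antisymm (le_inf inf_le_left ?_) (inf_le_inf_left _ (hmono (Nat.sub_le j 1)))
  rcases Nat.eq_zero_or_pos j with rfl | hjpos
  · exact inf_le_right
  have hji : j ≤ i := by
    by_contra! h
    exact hjmin i h ((hNF i).trans le_sup_right)
  set A := (F (i - 1)).map N
  have hW : F (j - 1) ⊔ A ⊓ F j ≤ F j := sup_le (hmono (Nat.sub_le j 1)) inf_le_right
  have hlt : F (j - 1) ⊔ A ⊓ F j < F j := by
    refine lt_of_le_of_ne hW fun h => hjmin (j - 1) (by omega) (hj.trans (sup_le le_sup_left ?_))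
    rw [← h]
    exact sup_le le_sup_right (inf_le_left.trans le_sup_left)
  have hrank := Submodule.finrank_lt_finrank_of_lt hlt
  rw [hdim j (hji.trans hin)] at hrank
  have heq : F (j - 1) = F (j - 1) ⊔ A ⊓ F j :=
    Submodule.eq_of_le_of_finrank_le le_sup_left (by rw [hdim (j - 1) (by omega)]; omega)
  rw [heq]
  exact le_sup_right
end

section
/- For 1 ≤ s < t ≤ n, the following are equivalent: (1) N(F_t) ⊆ N(F_{t−1}) + F_s and N(F_t) ⊄ N(F_{t−1}) + F_{s−1} (i.e. s is critical for F with t = t_F(s)); (2) N(F_{t−1}) ∩ F_s = N(F_{t−1}) ∩ F_{s−1} and N(F_t) ∩ F_s ≠ N(F_t) ∩ F_{s−1}. -/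
open Submodule

/-- In a modular lattice, for weakly covering pairs `a ⩿ b` and `p ⩿ q`, the step from `a` to `b`
is absorbed exactly when passing from `p` to `q` iff the meets with `p` and `q` agree for `a` but
not for `b`. -/
theorem WCovBy.le_sup_and_not_le_sup_iff {α : Type*} [Lattice α] [IsModularLattice α]
    {a b p q : α} (hab : a ⩿ b) (hpq : p ⩿ q) :
    (b ≤ a ⊔ q ∧ ¬ b ≤ a ⊔ p) ↔ (a ⊓ q = a ⊓ p ∧ b ⊓ q ≠ b ⊓ p) := by
  have inf_eq_iff : ∀ c : α, c ⊓ q = c ⊓ p ↔ c ⊓ q ≤ p := fun c =>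
    ⟨fun h => h.trans_le inf_le_right,
      fun h => le_antisymm (le_inf inf_le_left h) (inf_le_inf_left c hpq.le)⟩
  rw [Ne, inf_eq_iff, inf_eq_iff]
  constructor
  · rintro ⟨h, h'⟩
    refine ⟨?_, fun hb => h' ?_⟩
    · by_contra ha
      rcases hpq.eq_or_eq le_sup_left (sup_le hpq.le inf_le_right : p ⊔ a ⊓ q ≤ q) with hp | hq
      · exact ha (le_sup_right.trans_eq hp)
      · refine h' (h.trans (sup_le le_sup_left ?_))
        rw [← hq]
        exact sup_le le_sup_right (inf_le_left.trans le_sup_left)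
    · calc b ≤ (a ⊔ q) ⊓ b := le_inf h le_rfl
        _ = a ⊔ q ⊓ b := sup_inf_assoc_of_le q hab.le
        _ ≤ a ⊔ p := sup_le_sup_left (inf_comm q b ▸ hb) a
  · rintro ⟨ha, hb⟩
    refine ⟨?_, fun h => hb ?_⟩
    · rcases hab.eq_or_eq le_sup_left (sup_le hab.le inf_le_left : a ⊔ b ⊓ q ≤ b) with h | h
      · have hba : b ⊓ q ≤ a := le_sup_right.trans_eq h
        exact absurd ((le_inf hba inf_le_right).trans ha) hb
      · exact h.ge.trans (sup_le_sup_left inf_le_right a)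
    · calc b ⊓ q ≤ (p ⊔ a) ⊓ q := inf_le_inf_right q (h.trans_eq (sup_comm a p))
        _ = p ⊔ a ⊓ q := sup_inf_assoc_of_le a hpq.le
        _ ≤ p := sup_le le_rfl ha

/-- The image under a linear map of a weakly covering pair of submodules is weakly covering. -/
theorem Submodule.wcovBy_map {R M M' : Type*} [Ring R] [AddCommGroup M] [Module R M]
    [AddCommGroup M'] [Module R M'] (f : M →ₗ[R] M') {X Y : Submodule R M} (h : X ⩿ Y) :
    X.map f ⩿ Y.map f := by
  refine ⟨Submodule.map_mono h.le, fun C hXC hCY => ?_⟩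
  have hC : (Y ⊓ C.comap f).map f = C := by
    rw [← Submodule.map_inf_eq_map_inf_comap, inf_eq_right.mpr hCY.le]
  rcases h.eq_or_eq (le_inf h.le (Submodule.map_le_iff_le_comap.mp hXC.le)) inf_le_left with e | e
  · exact hXC.ne (e ▸ hC)
  · exact hCY.ne' (e ▸ hC)

/-- Nested subspaces whose dimensions differ by at most one form a weakly covering pair. -/
theorem Submodule.wcovBy_of_finrank_le {K V : Type*} [DivisionRing K] [AddCommGroup V]
    [Module K V] [FiniteDimensional K V] {X Y : Submodule K V} (h : X ≤ Y)
    (hd : Module.finrank K Y ≤ Module.finrank K X + 1) : X ⩿ Y := by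
  refine ⟨h, fun C hXC hCY => ?_⟩
  have h₁ := Submodule.finrank_lt_finrank_of_lt hXC
  have h₂ := Submodule.finrank_lt_finrank_of_lt hCY
  omega

/-- Let `F` be a refinement (full flag) of an `n`-dimensional `E`-vector space `D`, and
`N : D → D` a linear map with `N(F_i) ⊆ F_i`.  For `1 ≤ s < t ≤ n` the following are
equivalent: (1) `N(F_t) ⊆ N(F_{t-1}) + F_s` and `N(F_t) ⊄ N(F_{t-1}) + F_{s-1}` (i.e. `s`
is critical for `F` with `t = t_F(s)`); (2) `N(F_{t-1}) ∩ F_s = N(F_{t-1}) ∩ F_{s-1}` and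
`N(F_t) ∩ F_s ≠ N(F_t) ∩ F_{s-1}`. -/
theorem critical_iff (E D : Type*) [Field E] [AddCommGroup D] [Module E D]
    [FiniteDimensional E D] (n : ℕ) (hn : Module.finrank E D = n)
    (F : ℕ → Submodule E D) (hmono : Monotone F) (hF0 : F 0 = ⊥) (hFn : F n = ⊤)
    (hdim : ∀ r ≤ n, Module.finrank E (F r) = r)
    (N : D →ₗ[E] D) (hNF : ∀ r, (F r).map N ≤ F r)
    (s t : ℕ) (hs : 1 ≤ s) (hst : s < t) (htn : t ≤ n) :
    ((F t).map N ≤ (F (t - 1)).map N ⊔ F s ∧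
        ¬ ((F t).map N ≤ (F (t - 1)).map N ⊔ F (s - 1))) ↔
      ((F (t - 1)).map N ⊓ F s = (F (t - 1)).map N ⊓ F (s - 1) ∧
        (F t).map N ⊓ F s ≠ (F t).map N ⊓ F (s - 1)) := by
  have flag_wcovBy : ∀ r ≤ n, F (r - 1) ⩿ F r := fun r hr => by
    refine Submodule.wcovBy_of_finrank_le (hmono (Nat.sub_le r 1)) ?_
    rw [hdim r hr, hdim (r - 1) (by omega)]
    omega
  exact (Submodule.wcovBy_map N (flag_wcovBy t htn)).le_sup_and_not_le_sup_iff
    (flag_wcovBy s (by omega))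
end

section
/- If s is critical for F with t = t_F(s), then n+1−t is critical for F̌ (with respect to N^∨) with t_{F̌}(n+1−t) = n+1−s; that is, N^∨(F̌_{n+1−s}) ⊆ N^∨(F̌_{n−s}) + F̌_{n+1−t} and N^∨(F̌_{n+1−s}) ⊄ N^∨(F̌_{n−s}) + F̌_{n−t}. -/
theorem Subspace.map_dualMap_dualAnnihilator {K V W : Type*} [Field K] [AddCommGroup V]
    [Module K V] [AddCommGroup W] [Module K W] (f : V →ₗ[K] W) (U : Submodule K W) :
    U.dualAnnihilator.map f.dualMap = (U.comap f).dualAnnihilator := by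
  rw [← U.range_dualMap_mkQ_eq, ← LinearMap.range_comp, LinearMap.dualMap_comp_dualMap,
    LinearMap.range_dualMap_eq_dualAnnihilator_ker, LinearMap.ker_comp, Submodule.ker_mkQ]

theorem Subspace.map_neg_dualMap_dualAnnihilator_le_sup_iff {K V : Type*} [Field K]
    [AddCommGroup V] [Module K V] (f : V →ₗ[K] V) (A B C : Submodule K V) :
    A.dualAnnihilator.map (-f.dualMap) ≤
      B.dualAnnihilator.map (-f.dualMap) ⊔ C.dualAnnihilator ↔
      B.comap f ⊓ C ≤ A.comap f := by
  rw [Submodule.map_neg, Submodule.map_neg, Subspace.map_dualMap_dualAnnihilator,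
    Subspace.map_dualMap_dualAnnihilator, ← Subspace.dualAnnihilator_inf_eq,
    Subspace.dualAnnihilator_le_dualAnnihilator_iff]

theorem Submodule.le_sup_span_singleton_of_finrank_le {K V : Type*} [Field K]
    [AddCommGroup V] [Module K V] [FiniteDimensional K V] {A B : Submodule K V} (hAB : A ≤ B)
    (h : Module.finrank K B ≤ Module.finrank K A + 1) {z : V} (hzB : z ∈ B) (hzA : z ∉ A) :
    B ≤ A ⊔ K ∙ z := by
  have hlt : A < A ⊔ K ∙ z := by
    refine lt_of_le_not_ge le_sup_left fun hle => hzA ?_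
    exact hle (mem_sup_right (mem_span_singleton_self z))
  have hle : A ⊔ K ∙ z ≤ B := sup_le hAB ((span_singleton_le_iff_mem z B).2 hzB)
  exact (eq_of_le_of_finrank_le hle (h.trans (finrank_lt_finrank_of_lt hlt))).ge


open Submodule

/-- The dual refinement: `F̌_i = (F_{n-i})^⊥` . -/
def dualFlag {E D : Type*} [Field E] [AddCommGroup D] [Module E D]
    (n : ℕ) (F : ℕ → Submodule E D) (i : ℕ) : Submodule E (Module.Dual E D) :=
  (F (n - i)).dualAnnihilator

/-- If `s` is critical for `F` with `t = t_F(s)`, then `n+1-t` is critical for the dual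
refinement `F̌` with respect to `N^∨ = -N*`, with `t_{F̌}(n+1-t) = n+1-s`: that is,
`N^∨(F̌_{n+1-s}) ⊆ N^∨(F̌_{n-s}) + F̌_{n+1-t}` and
`N^∨(F̌_{n+1-s}) ⊄ N^∨(F̌_{n-s}) + F̌_{n-t}`. -/
theorem dual_critical (E D : Type*) [Field E] [AddCommGroup D] [Module E D]
    [FiniteDimensional E D] (n : ℕ) (hn : Module.finrank E D = n)
    (F : ℕ → Submodule E D) (hmono : Monotone F) (hF0 : F 0 = ⊥) (hFn : F n = ⊤)
    (hdim : ∀ r ≤ n, Module.finrank E (F r) = r)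
    (N : D →ₗ[E] D) (hNF : ∀ r, (F r).map N ≤ F r)
    (s t : ℕ) (hs : 1 ≤ s) (hst : s < t) (htn : t ≤ n)
    (hcrit1 : (F t).map N ≤ (F (t - 1)).map N ⊔ F s)
    (hcrit2 : ¬ ((F t).map N ≤ (F (t - 1)).map N ⊔ F (s - 1))) :
    (dualFlag n F (n + 1 - s)).map (-N.dualMap) ≤
      (dualFlag n F (n - s)).map (-N.dualMap) ⊔ dualFlag n F (n + 1 - t) ∧
    ¬ ((dualFlag n F (n + 1 - s)).map (-N.dualMap) ≤
      (dualFlag n F (n - s)).map (-N.dualMap) ⊔ dualFlag n F (n - t)) := by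
  simp only [dualFlag, show n - (n + 1 - s) = s - 1 by lia, show n - (n - s) = s by lia,
    show n - (n + 1 - t) = t - 1 by lia, show n - (n - t) = t by lia,
    Subspace.map_neg_dualMap_dualAnnihilator_le_sup_iff]
  constructor
  · rintro u ⟨hus, hut⟩
    by_contra hu
    have hspan : F s ≤ F (s - 1) ⊔ E ∙ N u := by
      refine le_sup_span_singleton_of_finrank_le (hmono (Nat.sub_le s 1)) ?_ hus hu
      rw [hdim s (by lia), hdim (s - 1) (by lia)]
      lia
    refine hcrit2 (hcrit1.trans (sup_le le_sup_left (hspan.trans (sup_le le_sup_right ?_))))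
    rw [span_singleton_le_iff_mem]
    exact mem_sup_left (mem_map_of_mem hut)
  · contrapose! hcrit2
    rintro _ ⟨v, hv, rfl⟩
    obtain ⟨_, ⟨w, hw, rfl⟩, y, hy, hwy⟩ := mem_sup.1 (hcrit1 (mem_map_of_mem hv))
    have hNy : N (v - w) = y := by rw [map_sub, ← hwy, add_sub_cancel_left]
    have hvw : v - w ∈ F t := sub_mem hv (hmono (Nat.sub_le t 1) hw)
    have hmem : N (v - w) ∈ F (s - 1) :=
      hcrit2 ⟨by simpa only [SetLike.mem_coe, mem_comap, hNy], hvw⟩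
    rw [← hwy, ← hNy]
    exact add_mem (mem_sup_left (mem_map_of_mem hw)) (mem_sup_right hmem)
end

section
/- Suppose 1 ≤ s < t ≤ n, N(e_t) = e_s, and N(F_{t−1}) ∩ F_s = N(F_{t−1}) ∩ F_{s−1}. Then N^∨(e*_s) + e*_t ∈ F̌_{n−t} + N^∨(F̌_{n−s}). (This is the key step in showing that the operator N_{F̌} on the graded module of the dual is dual to −N_F.) -/
open Submodule

/-- Let `{e_1,…,e_n}` be a basis of `D` adapted to the refinement `F`
(`F_r = span(e_1,…,e_r)`) with dual basis `{e*_1,…,e*_n}`.  If `N(e_t) = e_s` and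
`N(F_{t-1}) ∩ F_s = N(F_{t-1}) ∩ F_{s-1}`, then
`N^∨(e*_s) + e*_t ∈ F̌_{n-t} + N^∨(F̌_{n-s})`, where `N^∨ = -N*`.  (This is the key step
in showing that `N_{F̌}` is dual to `-N_F`.) -/
theorem dual_graded_monodromy_key (E D : Type*) [Field E] [AddCommGroup D] [Module E D]
    [FiniteDimensional E D] (n : ℕ) (hn : Module.finrank E D = n)
    (F : ℕ → Submodule E D) (hmono : Monotone F) (hF0 : F 0 = ⊥) (hFn : F n = ⊤)
    (hdim : ∀ r ≤ n, Module.finrank E (F r) = r)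
    (N : D →ₗ[E] D) (hNF : ∀ r, (F r).map N ≤ F r)
    (e : ℕ → D) (e' : ℕ → Module.Dual E D)
    (hindep : LinearIndependent E (fun j : Fin n => e (j.val + 1)))
    (hspan : ∀ r ≤ n, F r = Submodule.span E (e '' {j | 1 ≤ j ∧ j ≤ r}))
    (hdual : ∀ i j, 1 ≤ i → i ≤ n → 1 ≤ j → j ≤ n →
      e' i (e j) = if i = j then 1 else 0)
    (s t : ℕ) (hs : 1 ≤ s) (hst : s < t) (htn : t ≤ n)
    (hNet : N (e t) = e s)
    (hinter : (F (t - 1)).map N ⊓ F s = (F (t - 1)).map N ⊓ F (s - 1)) :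
    (-N.dualMap) (e' s) + e' t ∈
      dualFlag n F (n - t) ⊔ (dualFlag n F (n - s)).map (-N.dualMap) := by
  have hle : span E (e '' {j | 1 ≤ j ∧ j ≤ s - 1}) ≤ LinearMap.ker (e' s) := by
    rw [span_le]
    rintro _ ⟨j, ⟨hj1, hj2⟩, rfl⟩
    simp [hdual s j hs (by omega) hj1 (by omega), show s ≠ j by omega]
  have hes : e' s ∈ (F s ⊓ (F (t - 1)).map N).dualAnnihilator := by
    rw [mem_dualAnnihilator]
    intro w hw
    rw [inf_comm, hinter, mem_inf, hspan (s - 1) (by omega)] at hw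
    exact hle hw.2
  rw [Subspace.dualAnnihilator_inf_eq, mem_sup] at hes
  obtain ⟨g, hg, h, hh, hgh⟩ := hes
  rw [mem_dualAnnihilator] at hh
  have hmem (r j : ℕ) (hr : r ≤ n) (hj : 1 ≤ j) (hjr : j ≤ r) : e j ∈ F r := by
    rw [hspan r hr]
    exact subset_span ⟨j, ⟨hj, hjr⟩, rfl⟩
  have hhs : h (e s) = 1 := by
    have hge : g (e s) = 0 :=
      (mem_dualAnnihilator g).1 hg _ (hmem s s (by omega) hs le_rfl)
    have heval := LinearMap.congr_fun hgh (e s)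
    simpa [hge, hdual s s hs (by omega) hs (by omega)] using heval
  have hker : F t ≤ LinearMap.ker (e' t - h ∘ₗ N) := by
    rw [hspan t htn, span_le]
    rintro _ ⟨j, ⟨hj1, hj2⟩, rfl⟩
    rcases hj2.eq_or_lt with rfl | hjt
    · simp [hNet, hhs, hdual j j hj1 htn hj1 htn]
    · have hhj := hh _ (mem_map_of_mem (f := N) (hmem (t - 1) j (by omega) hj1 (by omega)))
      simp [hhj, hdual t j (by omega) htn hj1 (by omega), hjt.ne']
  rw [dualFlag, dualFlag, Nat.sub_sub_self htn, Nat.sub_sub_self (hst.le.trans htn), mem_sup]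
  refine ⟨e' t - h ∘ₗ N, (mem_dualAnnihilator _).2 fun w hw => hker hw, _,
    mem_map_of_mem hg, ?_⟩
  ext x
  simp [← hgh]
  ring
end

section
/- There exists e ∈ D̃ with e ∉ D such that φ(e) = e and N(e) = 0. (Consequently the extension of the unit filtered (φ,N)-module by D splits; this is the key step in proving that a nontrivial extension of the trivial representation by a semistable representation with Hodge weights > 0 is not semistable.) -/
open Submodule

/-- An eigenvalue of the restriction of `φ` to an invariant subspace, mapped into an extension
field, is a root of the characteristic polynomial of that restriction. -/
theorem aeval_charpoly_restrict_eq_zero {K L V : Type*} [Field K] [Field L] [Algebra K L]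
    [AddCommGroup V] [Module K V] [FiniteDimensional K V] {φ : V →ₗ[K] V} {D : Submodule K V}
    (hφD : ∀ x ∈ D, φ x ∈ D) {c : K} {d : V} (hd : d ∈ D) (hd0 : d ≠ 0) (hφd : φ d = c • d) :
    Polynomial.aeval (algebraMap K L c) (φ.restrict hφD).charpoly = 0 := by
  have hev : Module.End.HasEigenvalue (φ.restrict hφD) c :=
    Module.End.hasEigenvalue_of_hasEigenvector (x := ⟨d, hd⟩)
      (Module.End.hasEigenvector_iff.mpr
        ⟨Module.End.mem_eigenspace_iff.mpr (Subtype.ext hφd), by simpa using hd0⟩)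
  have hroot := (Module.End.hasEigenvalue_iff_isRoot_charpoly _ _).mp hev
  rw [Polynomial.aeval_algebraMap_apply, Polynomial.coe_aeval_eq_eval, hroot.eq_zero, map_zero]

/-- Let `E` be a finite extension of `ℚ_p` and let `D̃` be a finite-dimensional
`E`-vector space with a bijective `φ` and a linear `N` satisfying `N ∘ φ = p · (φ ∘ N)`.
Let `D ⊂ D̃` be a codimension-one subspace with `φ(D) ⊆ D` and `N(D̃) ⊆ D`, such that `φ`
induces the identity on `D̃/D` and every eigenvalue of `φ|_D` in the algebraic closure of
`E` (with its unique valuation extending the `p`-adic one) has positive valuation, i.e.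
absolute value `< 1`.  Then there exists `e ∈ D̃ \ D` with `φ(e) = e` and `N(e) = 0`. -/
theorem exists_frobenius_fixed_vector (p : ℕ) [Fact p.Prime]
    (E : Type*) [Field E] [Algebra ℚ_[p] E] [FiniteDimensional ℚ_[p] E]
    (Dt : Type*) [AddCommGroup Dt] [Module E Dt] [FiniteDimensional E Dt]
    (φ N : Dt →ₗ[E] Dt) (hφbij : Function.Bijective φ)
    (hNφ : N ∘ₗ φ = algebraMap ℚ_[p] E (p : ℚ_[p]) • (φ ∘ₗ N))
    (D : Submodule E Dt) (hcodim : Module.finrank E D + 1 = Module.finrank E Dt)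
    (hφD : ∀ x ∈ D, φ x ∈ D) (hND : ∀ x : Dt, N x ∈ D)
    (hφid : ∀ x : Dt, φ x - x ∈ D)
    (v : Valuation (AlgebraicClosure E) NNReal)
    (hv : ∀ x : ℚ_[p], v (algebraMap ℚ_[p] (AlgebraicClosure E) x) = ‖x‖₊)
    (hval : ∀ μ : AlgebraicClosure E,
      (Polynomial.aeval μ) (LinearMap.charpoly (φ.restrict hφD)) = 0 → v μ < 1) :
    ∃ e : Dt, e ∉ D ∧ φ e = e ∧ N e = 0 := by
  have eigenvalue_lt_one : ∀ (c : E) (d : Dt), d ∈ D → d ≠ 0 → φ d = c • d →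
      v (algebraMap E (AlgebraicClosure E) c) < 1 := fun c d hd hd0 hφd =>
    hval _ (aeval_charpoly_restrict_eq_zero hφD hd hd0 hφd)
  have hsurj : Function.Surjective (φ.restrict hφD - (LinearMap.id : D →ₗ[E] D)) := by
    rw [← LinearMap.injective_iff_surjective, injective_iff_map_eq_zero]
    intro d hd
    by_contra hd0
    have hφd : φ d = d := by simpa [sub_eq_zero, Subtype.ext_iff] using hd
    simpa using eigenvalue_lt_one 1 d d.2 (by simpa using hd0) (by rw [hφd, one_smul])
  obtain ⟨x, hx⟩ : ∃ x, x ∉ D := by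
    by_contra! h
    rw [Submodule.eq_top_iff'.mpr h, finrank_top] at hcodim
    omega
  obtain ⟨d, hd⟩ := hsurj ⟨φ x - x, hφid x⟩
  have hd' : φ d - d = φ x - x := congrArg Subtype.val hd
  have hφe : φ (x - d) = x - d := by
    rw [map_sub, sub_eq_sub_iff_sub_eq_sub, ← hd']
  refine ⟨x - d, fun h => hx (by simpa using D.add_mem h d.2), hφe, ?_⟩
  by_contra hNe
  have hp : (p : ℚ_[p]) ≠ 0 := Nat.cast_ne_zero.mpr (Fact.out : p.Prime).ne_zero
  have hpE : algebraMap ℚ_[p] E p ≠ 0 := (map_ne_zero _).mpr hp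
  have hcomm : N (x - d) = algebraMap ℚ_[p] E p • φ (N (x - d)) := by
    simpa only [LinearMap.comp_apply, LinearMap.smul_apply, hφe] using
      LinearMap.congr_fun hNφ (x - d)
  have hlt := eigenvalue_lt_one (algebraMap ℚ_[p] E p)⁻¹ (N (x - d)) (hND _) hNe
    ((eq_inv_smul_iff₀ hpE).mpr hcomm.symm)
  rw [← map_inv₀, ← IsScalarTower.algebraMap_apply, hv, nnnorm_inv, ← NNReal.coe_lt_coe] at hlt
  have hone : (1 : ℝ) < p := mod_cast (Fact.out : p.Prime).one_lt
  have : (p : ℝ) < 1 := by simpa using hlt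
  linarith
end
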